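/- arXiv:2601.01681 — 3 statements merged into one kernel-verified Lean document; each statement's English description precedes it below -/
import Mathlib

section
/- For every median algebra X, ind(𝓜) = rank(X), where 𝓜 is the family of all median-preserving maps f : X → [0,1]. -/
open Set

/-- A median algebra: a ternary operation invariant under permutations of its
arguments, with `m x y y = y` and the standard associativity law. -/
structure MedianStruct (X : Type*) where
  med : X → X → X → X
  med_perm : ∀ (σ : Equiv.Perm (Fin 3)) (v : Fin 3 → X),
    med (v (σ 0)) (v (σ 1)) (v (σ 2)) = med (v 0) (v 1) (v 2)
  med_idem : ∀ x y : X, med x y y = y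
  med_assoc : ∀ x y z u w : X,
    med (med x y z) u w = med x (med y u w) (med z u w)

namespace MedianStruct

variable {X : Type*}

/-- The interval `[x,y] = {z | m x y z = z}`. -/
def interval (M : MedianStruct X) (x y : X) : Set X := {z | M.med x y z = z}

/-- A set is convex if it contains the interval between any two of its points. -/
def IsConvex (M : MedianStruct X) (C : Set X) : Prop :=
  ∀ x ∈ C, ∀ y ∈ C, M.interval x y ⊆ C

/-- A halfspace: a convex set with convex complement. -/
def IsHalfspace (M : MedianStruct X) (H : Set X) : Prop :=
  M.IsConvex H ∧ M.IsConvex Hᶜ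

end MedianStruct

/-- Two sets are crossing if all four intersections of them/their complements
are nonempty. -/
def Crossing {X : Type*} (A B : Set X) : Prop :=
  (A ∩ B).Nonempty ∧ (A ∩ Bᶜ).Nonempty ∧ (Aᶜ ∩ B).Nonempty ∧ (Aᶜ ∩ Bᶜ).Nonempty

/-- A finite family of sets is (Rosenthal) independent. -/
def IndepSetFamily {X : Type*} {k : ℕ} (A : Fin k → Set X) : Prop :=
  ∀ P M : Finset (Fin k), Disjoint P M →
    ((⋂ i ∈ P, A i) ∩ ⋂ j ∈ M, (A j)ᶜ).Nonempty

/-- The independence number of a family of sets: the supremum of the sizes of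
independent finite subfamilies. -/
noncomputable def indSets {X : Type*} (𝒞 : Set (Set X)) : ℕ∞ :=
  ⨆ (k : ℕ) (_ : ∃ A : Fin k → Set X,
      (∀ i, A i ∈ 𝒞) ∧ Function.Injective A ∧ IndepSetFamily A), (k : ℕ∞)

/-- Majority (median) operation on `Bool`. -/
def boolMed (a b c : Bool) : Bool := (a && b) || (b && c) || (a && c)

/-- The coordinatewise majority median on a power of `Bool`. -/
def boolCubeMed (I : Type*) : MedianStruct (I → Bool) where
  med x y z := fun i => boolMed (x i) (y i) (z i)
  med_perm σ v := by
    funext i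
    exact (by decide :
      ∀ (τ : Equiv.Perm (Fin 3)) (w : Fin 3 → Bool),
        boolMed (w (τ 0)) (w (τ 1)) (w (τ 2)) = boolMed (w 0) (w 1) (w 2))
      σ (fun j => v j i)
  med_idem x y := by
    funext i
    exact (by decide : ∀ a b : Bool, boolMed a b b = b) (x i) (y i)
  med_assoc x y z u w := by
    funext i
    exact (by decide : ∀ a b c d e : Bool,
        boolMed (boolMed a b c) d e = boolMed a (boolMed b d e) (boolMed c d e))
      (x i) (y i) (z i) (u i) (w i)

/-- A median-preserving (MP) map between median algebras. -/
def IsMedianHom {X Y : Type*} (M : MedianStruct X) (N : MedianStruct Y)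
    (f : X → Y) : Prop :=
  ∀ x y z, f (M.med x y z) = N.med (f x) (f y) (f z)

/-- The rank of a median algebra: the supremum of the `n` such that the Boolean
hypercube `{0,1}ⁿ` embeds into it by an injective median-preserving map. -/
noncomputable def medRank {X : Type*} (M : MedianStruct X) : ℕ∞ :=
  ⨆ (n : ℕ) (_ : ∃ f : (Fin n → Bool) → X,
      Function.Injective f ∧ IsMedianHom (boolCubeMed (Fin n)) M f), (n : ℕ∞)

/-- The median operation on `ℝ`. -/
noncomputable def realMed (a b c : ℝ) : ℝ := max (max (min a b) (min b c)) (min a c)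

/-- A real-valued median-preserving function on a median algebra. -/
def IsMedianPreserving {X : Type*} (M : MedianStruct X) (f : X → ℝ) : Prop :=
  ∀ x y z, f (M.med x y z) = realMed (f x) (f y) (f z)

/-- A finite sequence of real functions is independent with witnessing
constants `a < b`. -/
def IndepFunFinWith {X : Type*} {k : ℕ} (f : Fin k → X → ℝ) (a b : ℝ) : Prop :=
  ∀ P M : Finset (Fin k), Disjoint P M →
    ((⋂ i ∈ P, {x | f i x ≤ a}) ∩ ⋂ j ∈ M, {x | b ≤ f j x}).Nonempty

/-- A finite sequence of real functions is independent. -/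
def IndepFunFin {X : Type*} {k : ℕ} (f : Fin k → X → ℝ) : Prop :=
  ∃ a b : ℝ, a < b ∧ IndepFunFinWith f a b

/-- The independence number of a family of real functions: the supremum of the
lengths of independent finite sequences in the family. -/
noncomputable def indFun {X : Type*} (F : Set (X → ℝ)) : ℕ∞ :=
  ⨆ (k : ℕ) (_ : ∃ f : Fin k → X → ℝ, (∀ i, f i ∈ F) ∧ IndepFunFin f), (k : ℕ∞)

/-- An infinite sequence of real functions is independent. -/
def IndepFunSeq {X : Type*} (f : ℕ → X → ℝ) : Prop :=
  ∃ a b : ℝ, a < b ∧ ∀ P M : Finset ℕ, Disjoint P M →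
    ((⋂ i ∈ P, {x | f i x ≤ a}) ∩ ⋂ j ∈ M, {x | b ≤ f j x}).Nonempty

/-- A finite set `S` is shattered by a family of sets `𝒟`. -/
def Shatters {Y : Type*} (𝒟 : Set (Set Y)) (S : Finset Y) : Prop :=
  ∀ T : Set Y, T ⊆ ↑S → ∃ D ∈ 𝒟, D ∩ ↑S = T

/-- The VC-dimension of a family of sets. -/
noncomputable def vcDim {Y : Type*} (𝒟 : Set (Set Y)) : ℕ∞ :=
  ⨆ (k : ℕ) (_ : ∃ S : Finset Y, S.card = k ∧ Shatters 𝒟 S), (k : ℕ∞)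

/-- The dual set system of `𝒞`: on the ground set `𝒞`, the sets
`R_x = {C ∈ 𝒞 | x ∈ C}` for `x ∈ X`. -/
def dualSystem {X : Type*} (𝒞 : Set (Set X)) : Set (Set ↥𝒞) :=
  {R | ∃ x : X, R = {C : ↥𝒞 | x ∈ (C : Set X)}}

/-- The family of all continuous median-preserving maps `X → [0,1]`. -/
def MCfam {X : Type*} [TopologicalSpace X] (M : MedianStruct X) : Set (X → ℝ) :=
  {f | Continuous f ∧ IsMedianPreserving M f ∧ ∀ x, f x ∈ Set.Icc (0 : ℝ) 1}

/-- In a commutative semigroup with absorbing element `q` and an idempotent `a`: if `s * a` and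
`s' * a` lie below `z` and `z'`, and `z * z' = q`, then `s * s' * a = q`. -/
lemma op_eq_of_absorb {X : Type*} (op : X → X → X) [Std.Associative op] [Std.Commutative op]
    {a s s' z z' q : X} (haa : op a a = a) (h : op (op s a) z = op s a)
    (h' : op (op s' a) z' = op s' a) (hq : op z z' = q) (habs : ∀ c, op c q = q) :
    op (op s s') a = q := by
  calc op (op s s') a = op (op s s') (op a a) := by rw [haa]
    _ = op (op s a) (op s' a) := by ac_rfl
    _ = op (op (op s a) z) (op (op s' a) z') := by rw [h, h']
    _ = op (op (op s a) (op s' a)) (op z z') := by ac_rfl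
    _ = q := by rw [hq, habs]

namespace MedianStruct

section

variable {X : Type*} (M : MedianStruct X)

lemma med_swap_left (x y z : X) : M.med x y z = M.med y x z := by
  have h := M.med_perm (Equiv.swap 0 1) ![y, x, z]
  have h2 : (Equiv.swap (0 : Fin 3) 1) 2 = 2 := by decide
  simpa [h2] using h

lemma med_swap_right (x y z : X) : M.med x y z = M.med x z y := by
  have h := M.med_perm (Equiv.swap 1 2) ![x, z, y]
  have h0 : (Equiv.swap (1 : Fin 3) 2) 0 = 0 := by decide
  simpa [h0] using h

lemma med_rotate (x y z : X) : M.med x y z = M.med y z x := by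
  rw [M.med_swap_left, M.med_swap_right]

lemma med_self_left (x y : X) : M.med x x y = x := by
  rw [← M.med_rotate, M.med_idem]

lemma med_self_outer (x y : X) : M.med x y x = x := by
  rw [M.med_swap_right, M.med_self_left]

/-- For fixed `q`, the operation `m(·, ·, q)` is associative. -/
lemma med_base_assoc (a b c q : X) :
    M.med (M.med a b q) c q = M.med a (M.med b c q) q := by
  rw [M.med_assoc, M.med_self_outer q c]

/-- The meet of `s` and `a` based at `q` lies below every point of `[s, a]`. -/
lemma med_base_le {s a z : X} (q : X) (hz : M.med s a z = z) :
    M.med (M.med s a q) z q = M.med s a q := by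
  have h := M.med_assoc q q z s a
  rw [M.med_self_left, M.med_rotate z s a, hz] at h
  rw [← M.med_rotate q s a, ← M.med_rotate q _ z, ← h]

/-- The median of `z`, `z'` and a third point lies in `[z, z']`. -/
lemma med_med_self (z z' r : X) : M.med z z' (M.med z z' r) = M.med z z' r := by
  have h := M.med_assoc r z z' z z'
  rw [M.med_self_left, M.med_self_outer] at h
  rw [← M.med_rotate r z z', ← M.med_rotate _ z z', h]

/-- The union of the segments joining a convex set to a point is convex. -/
lemma med_join {s a z s' z' : X} (r : X) (hz : M.med s a z = z)
    (hz' : M.med s' a z' = z') :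
    M.med (M.med s s' (M.med z z' r)) a (M.med z z' r) = M.med z z' r := by
  have hq := M.med_med_self z z' r
  generalize M.med z z' r = q at hq ⊢
  have h1 := M.med_base_le q hz
  have h2 := M.med_base_le q hz'
  have : Std.Associative (fun b c => M.med b c q) := ⟨fun b c d => M.med_base_assoc b c d q⟩
  have : Std.Commutative (fun b c => M.med b c q) := ⟨fun b c => M.med_swap_left b c q⟩
  exact op_eq_of_absorb (fun b c => M.med b c q) (M.med_self_left a q) h1 h2 hq
    fun c => M.med_idem c q

/-- If `y ∈ [s, a]` and `y ∈ [s', b]`, then `y` lies in the convex hull of `s`, `s'` and any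
point of `[a, b]`. -/
lemma med_pasch {s a y s' b : X} (c : X) (ha : M.med s a y = y) (hb : M.med s' b y = y) :
    M.med (M.med a b c) (M.med s s' y) y = y := by
  have h1 : M.med a (M.med s s' y) y = y := by
    rw [M.med_swap_left, M.med_swap_left s s', M.med_assoc, ha, M.med_self_outer, M.med_idem]
  have h2 : M.med b (M.med s s' y) y = y := by
    rw [M.med_swap_left, M.med_assoc, hb, M.med_self_outer, M.med_idem]
  rw [M.med_assoc, h2, ← M.med_rotate, M.med_base_assoc, M.med_swap_left _ a, h1, M.med_idem]

/-- A median-preserving map to the two-point median algebra. -/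
def IsBoolHom (h : X → Bool) : Prop :=
  ∀ a b c, h (M.med a b c) = boolMed (h a) (h b) (h c)

/-- Median-preserving maps to the two-point median algebra separate points. -/
theorem exists_isBoolHom_separating {x y : X} (hxy : x ≠ y) :
    ∃ h : X → Bool, M.IsBoolHom h ∧ h x = true ∧ h y = false := by
  classical
  obtain ⟨S, hxS, hS⟩ := zorn_subset_nonempty
    {S : Set X | (∀ a ∈ S, ∀ b ∈ S, ∀ c, M.med a b c ∈ S) ∧ y ∉ S}
    (by
      intro C hC hchain _
      refine ⟨⋃₀ C, ⟨?_, ?_⟩, fun s hs => subset_sUnion_of_mem hs⟩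
      · rintro a ⟨s, hs, has⟩ b ⟨t, ht, hbt⟩ c
        rcases hchain.total hs ht with h | h
        · exact ⟨t, ht, (hC ht).1 a (h has) b hbt c⟩
        · exact ⟨s, hs, (hC hs).1 a has b (h hbt) c⟩
      · rintro ⟨s, hs, hy⟩
        exact (hC hs).2 hy)
    {x} (by
      refine ⟨?_, fun h => hxy h.symm⟩
      rintro a rfl b rfl c
      exact M.med_self_left _ _)
  obtain ⟨⟨hconv, hyS⟩, hmax⟩ := hS
  have hx : x ∈ S := hxS rfl
  have hjoin : ∀ a ∉ S, ∃ s ∈ S, M.med s a y = y := by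
    intro a ha
    by_contra hcon
    have hle := hmax (y := {z | ∃ s ∈ S, M.med s a z = z})
      ⟨by
        rintro z ⟨s, hs, hz⟩ z' ⟨s', hs', hz'⟩ r
        exact ⟨_, hconv s hs s' hs' _, M.med_join r hz hz'⟩, hcon⟩
      fun s hs => ⟨s, hs, M.med_self_outer s a⟩
    exact ha (hle ⟨x, hx, M.med_idem x a⟩)
  have hcompl : ∀ a ∉ S, ∀ b ∉ S, ∀ c, M.med a b c ∉ S := by
    intro a ha b hb c hw
    obtain ⟨s, hs, hsy⟩ := hjoin a ha
    obtain ⟨s', hs', hsy'⟩ := hjoin b hb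
    have h := M.med_pasch c hsy hsy'
    exact hyS (h ▸ hconv _ hw _ (hconv s hs s' hs' y) y)
  refine ⟨fun z => decide (z ∈ S), ?_, by simpa using hx, by simpa using hyS⟩
  intro a b c
  have r1 := M.med_rotate a b c
  have r3 := M.med_swap_right a b c
  by_cases ha : a ∈ S <;> by_cases hb : b ∈ S <;> by_cases hc : c ∈ S <;>
    simp only [ha, hb, hc, boolMed, decide_true, decide_false, Bool.and_true, Bool.and_false,
      Bool.or_true, Bool.or_false, decide_eq_true_eq, decide_eq_false_iff_not] <;>
    first
    | exact hconv a ha b hb c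
    | exact hcompl a ha b hb c
    | (rw [r3]; first | exact hconv a ha c hc b | exact hcompl a ha c hc b)
    | (rw [r1]; first | exact hconv b hb c hc a | exact hcompl b hb c hc a)

lemma eq_of_forall_isBoolHom {p q : X} (h : ∀ g, M.IsBoolHom g → g p = g q) : p = q := by
  by_contra hne
  obtain ⟨g, hg, hp, hq⟩ := M.exists_isBoolHom_separating hne
  simpa [hp, hq] using h g hg

/-- Baker–Pixley interpolation: a Boolean function of the restrictions of two-valued
median-preserving maps to a finite family is realized by a point as soon as every pair of its
values is realized by a member of the family. -/
theorem exists_forall_isBoolHom_eq {V : Type*} [Fintype V] (x : V → X) (φ : (V → Bool) → Bool)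
    (hφ : ∀ g g', ∃ u, g u = φ g ∧ g' u = φ g') :
    ∃ p, ∀ h, M.IsBoolHom h → h p = φ (h ∘ x) := by
  classical
  have key : ∀ F : Finset (V → Bool), ∀ g g', ∃ p, ∀ h, M.IsBoolHom h →
      (h ∘ x ∈ F ∨ h ∘ x = g ∨ h ∘ x = g') → h p = φ (h ∘ x) := by
    intro F
    induction F using Finset.induction_on with
    | empty =>
      intro g g'
      obtain ⟨u, hu, hu'⟩ := hφ g g'
      refine ⟨x u, fun h _ hmem => ?_⟩
      rcases hmem with hmem | hmem | hmem
      · simp at hmem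
      · rw [hmem, ← hu, ← hmem]; rfl
      · rw [hmem, ← hu', ← hmem]; rfl
    | insert a F _ ih =>
      intro g g'
      obtain ⟨p, hp⟩ := ih a g
      obtain ⟨q, hq⟩ := ih a g'
      obtain ⟨r, hr⟩ := ih g g'
      refine ⟨M.med p q r, fun h hh hmem => ?_⟩
      have maj : ∀ b c d : Bool, boolMed b b c = b ∧ boolMed b c b = b ∧ boolMed c b b = b := by
        decide
      have := maj (φ (h ∘ x))
      rw [hh]
      rw [Finset.mem_insert] at hmem
      rcases hmem with (hmem | hmem) | hmem | hmem
      · rw [hp h hh (by simp [hmem]), hq h hh (by simp [hmem])]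
        exact (this _ true).1
      · rw [hp h hh (by simp [hmem]), hq h hh (by simp [hmem])]
        exact (this _ true).1
      · rw [hp h hh (by simp [hmem]), hr h hh (by simp [hmem])]
        exact (this _ true).2.1
      · rw [hq h hh (by simp [hmem]), hr h hh (by simp [hmem])]
        exact (this _ true).2.2
  obtain ⟨p, hp⟩ := key Finset.univ (fun _ => true) (fun _ => true)
  exact ⟨p, fun h hh => hp h hh (Or.inl (Finset.mem_univ _))⟩

end

end MedianStruct

/-- The sign `±1` of a Boolean value. -/
def boolSign (b : Bool) : ℤ := if b then 1 else -1

lemma boolSign_not (b : Bool) : boolSign (!b) = -boolSign b := by cases b <;> rfl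

section CubeRetraction

variable {k : ℕ}

/-- A function on the cube which is a coordinate or the negation of a coordinate. -/
def IsSignedCoord (g : (Fin k → Bool) → Bool) : Prop :=
  ∃ i b, ∀ u, g u = xor (u i) b

lemma IsSignedCoord.not {g : (Fin k → Bool) → Bool} (hg : IsSignedCoord g) :
    IsSignedCoord fun u => !g u := by
  obtain ⟨i, b, h⟩ := hg
  exact ⟨i, !b, fun u => by simp [h]⟩

lemma isSignedCoord_not_iff {g : (Fin k → Bool) → Bool} :
    IsSignedCoord (fun u => !g u) ↔ IsSignedCoord g :=
  ⟨fun h => by simpa using h.not, IsSignedCoord.not⟩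

lemma IsSignedCoord.sum_boolSign {g : (Fin k → Bool) → Bool} (hg : IsSignedCoord g) :
    ∑ u, boolSign (g u) = 0 := by
  obtain ⟨i, b, h⟩ := hg
  have hinv : Function.Involutive fun (u : Fin k → Bool) j => !u j := fun u => by simp
  have h1 : ∑ u, boolSign (g u) = ∑ u, -boolSign (g u) := by
    rw [← Equiv.sum_comp hinv.toPerm]
    refine Finset.sum_congr rfl fun u _ => ?_
    rw [← boolSign_not]
    simp [h]
  rw [Finset.sum_neg_distrib] at h1
  omega

open Classical in
/-- The vertex at which ties are broken: `v` for signed coordinates, a fixed vertex otherwise. -/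
noncomputable def tieVertex (v : Fin k → Bool) (g : (Fin k → Bool) → Bool) : Fin k → Bool :=
  if IsSignedCoord g then v else fun _ => false

lemma tieVertex_not (v : Fin k → Bool) (g : (Fin k → Bool) → Bool) :
    tieVertex v (fun u => !g u) = tieVertex v g := by
  by_cases hg : IsSignedCoord g
  · rw [tieVertex, tieVertex, if_pos hg, if_pos (isSignedCoord_not_iff.2 hg)]
  · rw [tieVertex, tieVertex, if_neg hg, if_neg (mt isSignedCoord_not_iff.1 hg)]

/-- The total weight of `g`, with ties broken at `tieVertex v g`. -/
noncomputable def cubeWeight (v : Fin k → Bool) (g : (Fin k → Bool) → Bool) : ℤ :=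
  2 * ∑ u, boolSign (g u) + boolSign (g (tieVertex v g))

/-- The weighted majority vote of `g`. -/
noncomputable def cubeVote (v : Fin k → Bool) (g : (Fin k → Bool) → Bool) : Bool :=
  decide (0 < cubeWeight v g)

lemma cubeWeight_not (v : Fin k → Bool) (g : (Fin k → Bool) → Bool) :
    cubeWeight v (fun u => !g u) = -cubeWeight v g := by
  simp only [cubeWeight, boolSign_not, tieVertex_not, Finset.sum_neg_distrib]
  ring

lemma cubeWeight_ne_zero (v : Fin k → Bool) (g : (Fin k → Bool) → Bool) :
    cubeWeight v g ≠ 0 := by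
  unfold cubeWeight
  generalize g (tieVertex v g) = b
  cases b <;> simp only [boolSign] <;> simp <;> omega

lemma cubeVote_not (v : Fin k → Bool) (g : (Fin k → Bool) → Bool) :
    cubeVote v (fun u => !g u) = !cubeVote v g := by
  have h := cubeWeight_ne_zero v g
  rw [cubeVote, cubeVote, cubeWeight_not, ← decide_not]
  refine decide_eq_decide.2 ?_
  omega

lemma exists_eq_true_of_cubeVote (v : Fin k → Bool) {g g' : (Fin k → Bool) → Bool}
    (hg : cubeVote v g = true) (hg' : cubeVote v g' = true) :
    ∃ u, g u = true ∧ g' u = true := by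
  by_contra! hcon
  have hle : ∀ u, 0 ≤ -(boolSign (g u) + boolSign (g' u)) := by
    intro u
    have := hcon u
    cases h : g u <;> cases h' : g' u <;> simp_all [boolSign]
  have hb : ∀ b, boolSign b ≤ 1 := by decide
  simp only [cubeVote, decide_eq_true_eq] at hg hg'
  have hsum : ∑ u, -(boolSign (g u) + boolSign (g' u)) = 0 := by
    refine le_antisymm ?_ (Finset.sum_nonneg fun u _ => hle u)
    rw [Finset.sum_neg_distrib, Finset.sum_add_distrib]
    unfold cubeWeight at hg hg'
    have := hb (g (tieVertex v g))
    have := hb (g' (tieVertex v g'))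
    omega
  have hzero := (Finset.sum_eq_zero_iff_of_nonneg fun u _ => hle u).1 hsum
  have hnot : g' = fun u => !g u := by
    funext u
    have := hzero u (Finset.mem_univ u)
    cases h : g u <;> cases h' : g' u <;> simp_all [boolSign]
  rw [hnot, cubeWeight_not] at hg'
  omega

lemma exists_eq_cubeVote (v : Fin k → Bool) (g g' : (Fin k → Bool) → Bool) :
    ∃ u, g u = cubeVote v g ∧ g' u = cubeVote v g' := by
  have flip : ∀ g : (Fin k → Bool) → Bool, ∃ f : (Fin k → Bool) → Bool, cubeVote v f = true ∧
      ∀ u, f u = true → g u = cubeVote v g := by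
    intro g
    cases h : cubeVote v g
    · exact ⟨fun u => !g u, by rw [cubeVote_not, h]; rfl, by simp⟩
    · exact ⟨g, h, fun u hu => hu⟩
  obtain ⟨f, hf, hfg⟩ := flip g
  obtain ⟨f', hf', hfg'⟩ := flip g'
  obtain ⟨u, hu, hu'⟩ := exists_eq_true_of_cubeVote v hf hf'
  exact ⟨u, hfg u hu, hfg' u hu'⟩

lemma IsSignedCoord.cubeVote_eq {g : (Fin k → Bool) → Bool} (hg : IsSignedCoord g)
    (v : Fin k → Bool) : cubeVote v g = g v := by
  rw [cubeVote, cubeWeight, hg.sum_boolSign, tieVertex, if_pos hg]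
  cases g v <;> rfl

/-- The vote on a fixed function depends on the vertex in a median-preserving way. -/
lemma cubeVote_med (g : (Fin k → Bool) → Bool) (v w z : Fin k → Bool) :
    cubeVote ((boolCubeMed (Fin k)).med v w z) g =
      boolMed (cubeVote v g) (cubeVote w g) (cubeVote z g) := by
  by_cases hg : IsSignedCoord g
  · simp only [hg.cubeVote_eq]
    obtain ⟨i, b, h⟩ := hg
    simp only [h]
    exact (by decide : ∀ b c d e : Bool,
      xor (boolMed c d e) b = boolMed (xor c b) (xor d b) (xor e b)) b (v i) (w i) (z i)
  · simp only [cubeVote, cubeWeight, tieVertex, if_neg hg]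
    exact ((by decide : ∀ b, b = boolMed b b b) _)

end CubeRetraction

namespace MedianStruct

/-- A family of two-valued median-preserving maps realizing all sign patterns yields a cube. -/
theorem exists_cube_of_isBoolHom {X : Type*} (M : MedianStruct X) {k : ℕ} (h : Fin k → X → Bool)
    (hh : ∀ i, M.IsBoolHom (h i)) (x : (Fin k → Bool) → X) (hx : ∀ v i, h i (x v) = v i) :
    ∃ f : (Fin k → Bool) → X,
      Function.Injective f ∧ IsMedianHom (boolCubeMed (Fin k)) M f := by
  choose p hp using fun v => M.exists_forall_isBoolHom_eq x (cubeVote v) (exists_eq_cubeVote v)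
  refine ⟨p, fun v w hvw => ?_, fun v w z => ?_⟩
  · funext i
    have hc : IsSignedCoord (h i ∘ x) := ⟨i, false, fun u => by simp [hx]⟩
    have := hp v (h i) (hh i)
    rw [hvw, hp w (h i) (hh i), hc.cubeVote_eq, hc.cubeVote_eq] at this
    simpa [hx] using this.symm
  · refine M.eq_of_forall_isBoolHom fun g hg => ?_
    rw [hp _ g hg, hg, hp _ g hg, hp _ g hg, hp _ g hg, cubeVote_med]

/-- An embedded cube yields two-valued median-preserving maps restricting to the coordinates. -/
theorem exists_isBoolHom_of_cube {X : Type*} (M : MedianStruct X) {n : ℕ}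
    {f : (Fin n → Bool) → X} (hf : Function.Injective f)
    (hfm : IsMedianHom (boolCubeMed (Fin n)) M f) :
    ∃ h : Fin n → X → Bool, (∀ i, M.IsBoolHom (h i)) ∧ ∀ v i, h i (f v) = v i := by
  have key : ∀ i, ∃ h : X → Bool, M.IsBoolHom h ∧ ∀ v, h (f v) = v i := by
    intro i
    set e : Fin n → Bool := Function.update (fun _ => false) i true with he
    set o : Fin n → Bool := fun _ => false with ho
    have hne : f e ≠ f o := fun h => by
      have := congrFun (hf h) i
      simp [he, ho] at this
    obtain ⟨h, hh, h1, h0⟩ := M.exists_isBoolHom_separating hne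
    refine ⟨h, hh, fun v => ?_⟩
    have hm := hh (f e) (f o) (f v)
    have hval : (boolCubeMed (Fin n)).med e o v = if v i then e else o := by
      funext j
      change boolMed (e j) (o j) (v j) = _
      by_cases hj : j = i
      · subst hj
        cases hv : v j <;> simp [he, ho, boolMed]
      · cases hv : v i <;> simp [he, ho, boolMed, hj]
    rw [← hfm, hval, h1, h0] at hm
    cases hv : v i <;> simp only [hv] at hm <;> cases hv' : h (f v) <;>
      simp_all [boolMed]
  choose h hh hv using key
  exact ⟨h, hh, fun v i => hv i v⟩

lemma isBoolHom_lt {X : Type*} (M : MedianStruct X) {f : X → ℝ} (hf : IsMedianPreserving M f)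
    (a : ℝ) : M.IsBoolHom fun z => decide (a < f z) := by
  intro x y z
  dsimp only
  rw [hf, Bool.eq_iff_iff]
  simp [realMed, boolMed]

lemma IsBoolHom.isMedianPreserving {X : Type*} {M : MedianStruct X} {h : X → Bool}
    (hh : M.IsBoolHom h) : IsMedianPreserving M fun z => if h z then 1 else 0 := by
  intro x y z
  simp only [hh x y z]
  cases h x <;> cases h y <;> cases h z <;> simp [realMed, boolMed]

end MedianStruct

/-- the independence number of the family of all median-preserving
maps `X → [0,1]` equals the rank of `X`. -/
theorem indFun_MP_eq_medRank {X : Type*} (M : MedianStruct X) :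
    indFun {f : X → ℝ | IsMedianPreserving M f ∧ ∀ x, f x ∈ Set.Icc (0 : ℝ) 1}
      = medRank M := by
  refine iSup_congr fun k => iSup_congr_Prop ⟨?_, ?_⟩ fun _ => rfl
  · rintro ⟨f, hf, a, b, hab, hind⟩
    have hpt : ∀ v : Fin k → Bool, ∃ x, ∀ i, decide (a < f i x) = v i := by
      intro v
      obtain ⟨x, hxP, hxM⟩ := hind {i | v i = false} {i | v i = true} (by
        rw [Finset.disjoint_left]
        simp +contextual)
      simp only [mem_iInter, Finset.mem_filter, Finset.mem_univ, true_and, mem_ofPred_eq]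
        at hxP hxM
      refine ⟨x, fun i => ?_⟩
      cases hv : v i
      · simpa using hxP i hv
      · simpa using hab.trans_le (hxM i hv)
    choose x hx using hpt
    exact M.exists_cube_of_isBoolHom _ (fun i => M.isBoolHom_lt (hf i).1 a) x hx
  · rintro ⟨f, hf, hfm⟩
    obtain ⟨h, hh, hv⟩ := M.exists_isBoolHom_of_cube hf hfm
    refine ⟨fun i z => if h i z then 1 else 0, fun i => ⟨(hh i).isMedianPreserving, fun z => ?_⟩,
      0, 1, one_pos, fun P N hPN => ⟨f fun i => decide (i ∈ N), ?_, ?_⟩⟩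
    · dsimp only
      split_ifs <;> simp
    · simp only [mem_iInter, mem_ofPred_eq, hv]
      intro i hi
      simp [Finset.disjoint_left.1 hPN hi]
    · simp only [mem_iInter, mem_ofPred_eq, hv]
      intro i hi
      simp [hi]
end

section
/- Let X be a median algebra and suppose (f_n)_{n∈ℕ} is an infinite independent sequence of median-preserving maps f_n : X → [0,1]. Then there exists an infinite sequence (A_n)_{n∈ℕ} of halfspaces of X such that every finite subfamily of {A_n : n ∈ ℕ} is an independent family of sets; in particular the halfspaces A_n are pairwise crossing. -/
open Set

/-- Sublevel sets of real-valued median-preserving functions are halfspaces. -/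
theorem IsMedianPreserving.isHalfspace_sublevel {X : Type*} {M : MedianStruct X} {f : X → ℝ}
    (hf : IsMedianPreserving M f) (a : ℝ) : M.IsHalfspace {x | f x ≤ a} := by
  constructor <;> intro x hx y hy z hz
  all_goals
    have h := hf x y z
    rw [show M.med x y z = z from hz, realMed] at h
    simp only [mem_compl_iff, mem_ofPred_eq, not_le] at hx hy ⊢
    grind

/-- Any two distinct members of an independent sequence of sets are crossing. -/
theorem crossing_of_indep {X : Type*} {A : ℕ → Set X}
    (hA : ∀ P Q : Finset ℕ, Disjoint P Q →
      ((⋂ i ∈ P, A i) ∩ ⋂ j ∈ Q, (A j)ᶜ).Nonempty)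
    {i j : ℕ} (hij : i ≠ j) : Crossing (A i) (A j) := by
  refine ⟨?_, ?_, ?_, ?_⟩
  · simpa using hA {i, j} ∅ (by simp)
  · simpa using hA {i} {j} (by simpa using hij)
  · simpa [inter_comm] using hA {j} {i} (by simpa using hij.symm)
  · simpa using hA ∅ {i, j} (by simp)

/-- from an infinite independent sequence of median-preserving
maps `X → [0,1]` one obtains an infinite sequence of halfspaces all of whose
finite subfamilies are independent; in particular they are pairwise crossing. -/
theorem exists_indep_halfspace_seq_of_indep_MP_seq {X : Type*}
    (M : MedianStruct X) (f : ℕ → X → ℝ)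
    (hf : ∀ n, IsMedianPreserving M (f n))
    (hrange : ∀ n x, f n x ∈ Set.Icc (0 : ℝ) 1)
    (hind : IndepFunSeq f) :
    ∃ A : ℕ → Set X, (∀ n, M.IsHalfspace (A n)) ∧
      (∀ P Q : Finset ℕ, Disjoint P Q →
        ((⋂ i ∈ P, A i) ∩ ⋂ j ∈ Q, (A j)ᶜ).Nonempty) ∧
      (∀ i j, i ≠ j → Crossing (A i) (A j)) := by
  obtain ⟨a, b, hab, h⟩ := hind
  have hA : ∀ P Q : Finset ℕ, Disjoint P Q →
      ((⋂ i ∈ P, {x | f i x ≤ a}) ∩ ⋂ j ∈ Q, {x | f j x ≤ a}ᶜ).Nonempty := fun P Q hPQ =>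
    (h P Q hPQ).mono <| inter_subset_inter_right _ <| iInter₂_mono fun _ _ _ hx =>
      not_le.2 (hab.trans_le hx)
  exact ⟨fun n => {x | f n x ≤ a}, fun n => (hf n).isHalfspace_sublevel a, hA,
    fun _ _ hij => crossing_of_indep hA hij⟩
end

section
/- Let X be a compact Hausdorff topological median algebra of finite rank. Then ind(𝓜𝓒) = rank(X), where 𝓜𝓒 is the family of all continuous median-preserving maps f : X → [0,1]. -/
open Set

section BooleanCubes

/-- A lattice contains no Boolean sublattice of dimension `n`. -/
def NoBoolCube (n : ℕ) (L : Type*) [Lattice L] : Prop :=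
  ∀ F : LatticeHom (Fin n → Bool) L, ¬ Function.Injective F

theorem NoBoolCube.dual {L : Type*} [Lattice L] {n : ℕ} (h : NoBoolCube n L) :
    NoBoolCube n Lᵒᵈ := by
  intro F hF
  refine h ⟨⟨fun A => OrderDual.ofDual (F Aᶜ), fun A B => ?_⟩, fun A B => ?_⟩ fun A B hAB => ?_
  · rw [compl_sup, map_inf]; rfl
  · change OrderDual.ofDual (F (A ⊓ B)ᶜ) = _
    rw [compl_inf, map_sup]; rfl
  · exact compl_injective (hF hAB)

variable {L : Type*} [DistribLattice L] [BoundedOrder L]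

theorem exists_boolCube_of_pairwise_inf_eq {k : ℕ} {s : L} {e : Fin k → L}
    (hs : ∀ i, s < e i) (hd : ∀ i j, i ≠ j → e i ⊓ e j = s) :
    ∃ F : LatticeHom (Fin k → Bool) L, Function.Injective F := by
  classical
  let S : (Fin k → Bool) → Finset (Fin k) := fun A => Finset.univ.filter fun i => A i = true
  have hS : ∀ A i, i ∈ S A ↔ A i = true := fun A i => by simp [S]
  let F : LatticeHom (Fin k → Bool) L :=
    { toFun := fun A => s ⊔ (S A).sup e
      map_sup' := fun A B => by
        have : S (A ⊔ B) = S A ∪ S B := by ext i; simp [hS]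
        rw [this, Finset.sup_union, sup_sup_distrib_left]
      map_inf' := fun A B => by
        rw [← sup_inf_left]
        apply le_antisymm
        · refine sup_le_sup_left (le_inf (Finset.sup_mono fun i => ?_)
            (Finset.sup_mono fun i => ?_)) s
          · simp +contextual [hS]
          · simp +contextual [hS]
        · rw [Finset.sup_inf_sup]
          refine sup_le le_sup_left (Finset.sup_le ?_)
          rintro ⟨i, j⟩ hij
          rw [Finset.mem_product, hS, hS] at hij
          obtain rfl | hne := eq_or_ne i j
          · rw [inf_idem]
            exact le_sup_of_le_right (Finset.le_sup (by simpa [hS] using hij))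
          · rw [hd i j hne]
            exact le_sup_left }
  have key : ∀ A i, e i ≤ F A ↔ A i = true := by
    intro A i
    refine ⟨fun h => ?_, fun h => le_sup_of_le_right (Finset.le_sup ((hS A i).2 h))⟩
    by_contra hA
    refine (hs i).not_ge ?_
    rw [← inf_eq_left.2 h]
    change e i ⊓ (s ⊔ (S A).sup e) ≤ s
    rw [inf_sup_left, Finset.sup_inf_distrib_left]
    refine sup_le inf_le_right (Finset.sup_le fun j hj => (hd i j ?_).le)
    rintro rfl
    exact hA ((hS A i).1 hj)
  refine ⟨F, fun A B hAB => funext fun i => ?_⟩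
  rw [Bool.eq_iff_iff, ← key A i, ← key B i, hAB]

/-- In a distributive lattice without Boolean cubes of dimension `n`, every finite meet is
the meet of at most `n` of its terms. -/
theorem NoBoolCube.exists_subset_card_le {n : ℕ} (h : NoBoolCube n L) (S : Finset L) :
    ∃ T ⊆ S, T.card ≤ n ∧ T.inf id = S.inf id := by
  classical
  induction S using Finset.strongInduction with
  | H S ih =>
    by_cases hc : S.card ≤ n
    · exact ⟨S, Finset.Subset.refl S, hc, rfl⟩
    by_cases hr : ∃ a ∈ S, (S.erase a).inf id = S.inf id
    · obtain ⟨a, ha, hae⟩ := hr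
      obtain ⟨T, hT, hTc, hTi⟩ := ih _ (Finset.erase_ssubset ha)
      exact ⟨T, hT.trans (Finset.erase_subset a S), hTc, hTi.trans hae⟩
    push Not at hr hc
    let g : Fin n → L := fun i => S.equivFin.symm (Fin.castLE hc.le i)
    have hg : Function.Injective g :=
      Subtype.val_injective.comp (S.equivFin.symm.injective.comp (Fin.castLE_injective hc.le))
    have hgS : ∀ i, g i ∈ S := fun i => (S.equivFin.symm (Fin.castLE hc.le i)).2
    obtain ⟨F, hF⟩ := exists_boolCube_of_pairwise_inf_eq (s := S.inf id)
      (e := fun i => (S.erase (g i)).inf id)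
      (fun i => lt_of_le_of_ne (Finset.inf_mono (Finset.erase_subset _ _))
        (hr _ (hgS i)).symm)
      (fun i j hij => by
        rw [← Finset.inf_union]
        congr 1
        ext a
        have : g i ≠ g j := hg.ne hij
        simp only [Finset.mem_union, Finset.mem_erase]
        grind)
    exact absurd hF (h F)

end BooleanCubes

section CompactLattices

open Filter Topology Order

variable {L : Type*} [DistribLattice L] [TopologicalSpace L] [TopologicalLattice L]

instance OrderDual.instT2Space {α : Type*} [TopologicalSpace α] [T2Space α] : T2Space αᵒᵈ :=
  ‹T2Space α›

instance OrderDual.instCompactSpace {α : Type*} [TopologicalSpace α] [CompactSpace α] :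
    CompactSpace αᵒᵈ :=
  ‹CompactSpace α›

theorem isClosed_Iic_of_topologicalLattice [T2Space L] (a : L) : IsClosed (Iic a) := by
  have : Iic a = {z | z ⊓ a = z} := by ext z; simp
  rw [this]
  exact isClosed_eq (by fun_prop) continuous_id

theorem isClosed_Ici_of_topologicalLattice [T2Space L] (a : L) : IsClosed (Ici a) :=
  isClosed_Iic_of_topologicalLattice (L := Lᵒᵈ) (OrderDual.toDual a)

theorem Iic_mem_nhds_of_le {a c w : L} (h : Iic w ∈ 𝓝 a) (hca : c ≤ a) : Iic w ∈ 𝓝 c := by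
  have hc : Tendsto (fun y => y ⊔ a) (𝓝 c) (𝓝 a) := by
    have : Continuous fun y : L => y ⊔ a := by fun_prop
    simpa [sup_eq_right.2 hca] using this.tendsto c
  filter_upwards [hc h] with y hy
  exact le_sup_left.trans hy

theorem Ici_mem_nhds_of_le {a c w : L} (h : Ici w ∈ 𝓝 a) (hac : a ≤ c) : Ici w ∈ 𝓝 c :=
  Iic_mem_nhds_of_le (L := Lᵒᵈ) (a := OrderDual.toDual a) (c := OrderDual.toDual c)
    (w := OrderDual.toDual w) h hac

variable [T2Space L] [CompactSpace L]

theorem exists_lowerBound_mem_closure {S : Set L} (hne : S.Nonempty)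
    (hd : ∀ a ∈ S, ∀ b ∈ S, ∃ c ∈ S, c ≤ a ∧ c ≤ b) :
    ∃ v ∈ closure S, ∀ a ∈ S, v ≤ a := by
  classical
  obtain ⟨v, hv, hv'⟩ := (isClosed_closure (s := S)).isCompact.inter_iInter_nonempty
    (fun a : S => Iic (a : L)) (fun a => isClosed_Iic_of_topologicalLattice _) fun u => by
      have : ∃ c ∈ S, ∀ a ∈ u, c ≤ (a : L) := by
        induction u using Finset.induction_on with
        | empty => exact ⟨hne.some, hne.some_mem, by simp⟩
        | insert a u _ ih =>
          obtain ⟨c, hc, hcu⟩ := ih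
          obtain ⟨d, hd, hda, hdc⟩ := hd a a.2 c hc
          exact ⟨d, hd, by
            simpa [Finset.forall_mem_insert] using
              ⟨hda, fun b hb hbu => hdc.trans (hcu ⟨b, hb⟩ hbu)⟩⟩
      obtain ⟨c, hc, hcu⟩ := this
      exact ⟨c, subset_closure hc, mem_iInter₂.2 hcu⟩
  exact ⟨v, hv, fun a ha => mem_iInter.1 hv' ⟨a, ha⟩⟩

theorem exists_upperBound_mem_closure {S : Set L} (hne : S.Nonempty)
    (hd : ∀ a ∈ S, ∀ b ∈ S, ∃ c ∈ S, a ≤ c ∧ b ≤ c) :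
    ∃ v ∈ closure S, ∀ a ∈ S, a ≤ v :=
  exists_lowerBound_mem_closure (L := Lᵒᵈ) hne hd

variable [BoundedOrder L]

/-- A compact distributive lattice of finite breadth has small subsemilattices. -/
theorem NoBoolCube.exists_Ici_mem_nhds {n : ℕ} (h : NoBoolCube n L) {q p : L} (hqp : ¬ q ≤ p) :
    ∃ v, ¬ v ≤ p ∧ Ici v ∈ 𝓝 q := by
  classical
  let Φ : (Fin n → L) → L := fun t => q ⊓ Finset.univ.inf t
  have hΦ : Continuous Φ := by
    refine continuous_const.inf ?_
    exact Continuous.finset_inf_apply fun i _ => continuous_apply i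
  have hΦq : Φ (fun _ => q) = q := inf_eq_left.2 (Finset.le_inf fun _ _ => le_rfl)
  have hW : Φ ⁻¹' (Iic p)ᶜ ∈ 𝓝 (fun _ : Fin n => q) :=
    hΦ.continuousAt.preimage_mem_nhds
      ((isClosed_Iic_of_topologicalLattice p).isOpen_compl.mem_nhds (by rw [hΦq]; exact hqp))
  rw [nhds_pi, Filter.mem_pi'] at hW
  obtain ⟨I, u, hu, huW⟩ := hW
  obtain ⟨N, hN, hNc, hNu⟩ := exists_mem_nhds_isClosed_subset
    (Filter.iInter_mem.2 hu : (⋂ i, u i) ∈ 𝓝 q)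
  have hqN : q ∈ N := mem_of_mem_nhds hN
  have hKc : IsClosed (Φ '' Set.pi univ fun _ => N) :=
    ((isCompact_univ_pi fun _ => hNc.isCompact).image hΦ).isClosed
  let S : Set L := {z | ∃ F : Finset L, (F : Set L) ⊆ N ∧ z = q ⊓ F.inf id}
  have hSK : S ⊆ Φ '' Set.pi univ fun _ => N := by
    rintro _ ⟨F, hF, rfl⟩
    obtain ⟨T, hTF, hTn, hT⟩ := h.exists_subset_card_le F
    let t : Fin n → L := fun i =>
      if hi : (i : ℕ) < T.card then (T.equivFin.symm ⟨i, hi⟩ : L) else q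
    refine ⟨t, fun i _ => ?_, ?_⟩
    · by_cases hi : (i : ℕ) < T.card
      · simp only [t, hi, dif_pos]
        exact hF (hTF (T.equivFin.symm ⟨i, hi⟩).2)
      · simpa only [t, hi, dif_neg, not_false_eq_true] using hqN
    · rw [← hT]
      apply le_antisymm
      · refine le_inf inf_le_left (Finset.le_inf fun a ha => ?_)
        have : t (Fin.castLE hTn (T.equivFin ⟨a, ha⟩)) = a := by simp [t]
        exact inf_le_right.trans ((Finset.inf_le (Finset.mem_univ _)).trans this.le)
      · refine le_inf inf_le_left (Finset.le_inf fun i _ => ?_)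
        by_cases hi : (i : ℕ) < T.card
        · simp only [t, hi, dif_pos]
          exact inf_le_right.trans (Finset.inf_le (T.equivFin.symm ⟨i, hi⟩).2)
        · simp only [t, hi, dif_neg, not_false_eq_true]
          exact inf_le_left
  obtain ⟨v, hv, hvS⟩ := exists_lowerBound_mem_closure (S := S)
    ⟨_, ∅, by simp, rfl⟩ (by
      rintro _ ⟨F, hF, rfl⟩ _ ⟨G, hG, rfl⟩
      refine ⟨_, ⟨F ∪ G, by simp [hF, hG], rfl⟩, ?_, ?_⟩
      · exact inf_le_inf_left q (Finset.inf_mono Finset.subset_union_left)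
      · exact inf_le_inf_left q (Finset.inf_mono Finset.subset_union_right))
  refine ⟨v, ?_, mem_of_superset hN fun a ha => ?_⟩
  · obtain ⟨t, ht, rfl⟩ := closure_minimal hSK hKc hv
    exact @huW t fun i _ => mem_iInter.1 (hNu (ht i trivial)) i
  · exact (hvS _ ⟨{a}, by simpa using ha, rfl⟩).trans (by simp)

theorem NoBoolCube.exists_Iic_mem_nhds {n : ℕ} (h : NoBoolCube n L) {q p : L} (hqp : ¬ q ≤ p) :
    ∃ v, ¬ q ≤ v ∧ Iic v ∈ 𝓝 p :=
  NoBoolCube.exists_Ici_mem_nhds (L := Lᵒᵈ) h.dual hqp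

/-- `c` lies in a closed ideal `Iic a` and the complement of `u` in a disjoint closed filter
`Ici b`. -/
def IdealSeparated (c u : Set L) : Prop :=
  ∃ a b : L, ¬ b ≤ a ∧ c ⊆ Iic a ∧ uᶜ ⊆ Ici b

omit [BoundedOrder L] [TopologicalSpace L] [T2Space L] [TopologicalLattice L] [CompactSpace L] in
theorem exists_isPrime_of_not_le {a b : L} (hba : ¬ b ≤ a) :
    ∃ J : Ideal L, J.IsPrime ∧ a ∈ J ∧ b ∉ J := by
  obtain ⟨J, hJ, hIJ, hFJ⟩ := DistribLattice.prime_ideal_of_disjoint_filter_ideal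
    (F := PFilter.principal b) (I := Ideal.principal a)
    (Set.disjoint_left.2 fun x hx hx' =>
      hba ((PFilter.mem_principal.1 hx).trans (Ideal.mem_principal.1 hx')))
  exact ⟨J, hJ, hIJ (Ideal.mem_principal.2 le_rfl),
    Set.disjoint_left.1 hFJ (PFilter.mem_principal.2 le_rfl)⟩

theorem NoBoolCube.exists_between {n : ℕ} (h : NoBoolCube n L) {c u : Set L}
    (hcu : IdealSeparated c u) :
    ∃ v, IsOpen v ∧ c ⊆ v ∧ closure v ⊆ u ∧ IdealSeparated c v ∧
      IdealSeparated (closure v) u := by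
  obtain ⟨a, b, hba, hca, hub⟩ := hcu
  obtain ⟨q, hqa, hqb⟩ := h.exists_Ici_mem_nhds hba
  obtain ⟨w, hqw, hwa⟩ := h.exists_Iic_mem_nhds hqa
  obtain ⟨J, hJ, hwJ, hqJ⟩ := exists_isPrime_of_not_le hqw
  have hIic : ∀ x ≤ a, x ∈ interior (J : Set L) := fun x hx =>
    mem_interior_iff_mem_nhds.2 <|
      mem_of_superset (Iic_mem_nhds_of_le hwa hx) fun y hy => J.lower hy hwJ
  have hIci : ∀ x, b ≤ x → x ∉ closure (J : Set L) := fun x hx hxJ => by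
    obtain ⟨y, hy, hyJ⟩ := mem_closure_iff_nhds.1 hxJ _ (Ici_mem_nhds_of_le hqb hx)
    exact hqJ (J.lower hy hyJ)
  obtain ⟨a', ha', hJa'⟩ := exists_upperBound_mem_closure (S := (J : Set L)) ⟨w, hwJ⟩
    fun x hx y hy => ⟨x ⊔ y, Ideal.sup_mem hx hy, le_sup_left, le_sup_right⟩
  obtain ⟨b', hb', hJb'⟩ := exists_lowerBound_mem_closure (S := (J : Set L)ᶜ) ⟨q, hqJ⟩
    fun x hx y hy => ⟨x ⊓ y, fun hxy => (hJ.mem_or_mem hxy).elim hx hy,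
      inf_le_left, inf_le_right⟩
  have hle : closure (interior (J : Set L)) ⊆ Iic a' :=
    closure_minimal (interior_subset.trans hJa') (isClosed_Iic_of_topologicalLattice _)
  refine ⟨interior J, isOpen_interior, fun x hx => hIic x (hca hx), fun x hx => ?_,
    ⟨a, b', fun hb => ?_, hca, ?_⟩, ⟨a', b, fun hb => hIci a' hb ha', hle, hub⟩⟩
  · by_contra hxu
    exact hIci x (hub hxu) (closure_mono interior_subset hx)
  · rw [closure_compl] at hb'
    exact hb' (hIic b' hb)
  · rw [← closure_compl]
    exact closure_minimal hJb' (isClosed_Ici_of_topologicalLattice _)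

omit [TopologicalLattice L] [T2Space L] [CompactSpace L] [BoundedOrder L] in
/-- The approximations in the Urysohn construction are uniformly close to lattice
homomorphisms. -/
theorem Urysohns.CU.exists_latticeHom_near_approx (m : ℕ)
    (c : Urysohns.CU (IdealSeparated (L := L))) :
    ∃ g : LatticeHom L ℝ, (∀ x, g x ∈ Icc (0 : ℝ) 1) ∧ (∀ x ∈ c.C, g x = 0) ∧
      (∀ x ∉ c.U, g x = 1) ∧ ∀ x, |g x - c.approx m x| ≤ (1 / 2) ^ m := by
  classical
  induction m generalizing c with
  | zero =>
    obtain ⟨a, b, hba, hca, hub⟩ := c.P_C_U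
    obtain ⟨J, hJ, haJ, hbJ⟩ := exists_isPrime_of_not_le hba
    have h01 : ∀ x, (if x ∈ J then 0 else 1 : ℝ) ∈ Icc (0 : ℝ) 1 := fun x => by
      split_ifs <;> simp
    refine ⟨⟨⟨fun x => if x ∈ J then 0 else 1, fun x y => ?_⟩, fun x y => ?_⟩, h01,
      fun x hx => if_pos (J.lower (hca hx) haJ),
      fun x hx => if_neg fun hxJ => hbJ (J.lower (hub hx) hxJ), fun x => ?_⟩
    · by_cases hx : x ∈ J <;> by_cases hy : y ∈ J <;> simp [hx, hy, Ideal.sup_mem_iff]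
    · have : x ⊓ y ∈ J ↔ x ∈ J ∨ y ∈ J :=
        ⟨hJ.mem_or_mem, fun h => h.elim (J.lower inf_le_left) (J.lower inf_le_right)⟩
      change (if x ⊓ y ∈ J then 0 else 1 : ℝ) = (if x ∈ J then 0 else 1) ⊓ (if y ∈ J then 0 else 1)
      by_cases hx : x ∈ J <;> by_cases hy : y ∈ J <;> simp [hx, hy, this]
    · have h1 := h01 x
      have h2 := c.approx_nonneg 0 x
      have h3 := c.approx_le_one 0 x
      rw [pow_zero, abs_le]
      change -1 ≤ (if x ∈ J then 0 else 1 : ℝ) - _ ∧ (if x ∈ J then 0 else 1 : ℝ) - _ ≤ 1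
      constructor <;> linarith [h1.1, h1.2]
  | succ m ih =>
    obtain ⟨l, hl, hlC, hlU, hla⟩ := ih c.left
    obtain ⟨r, hr, hrC, hrU, hra⟩ := ih c.right
    have hsplit : ∀ x, (r x = 0 ∧ c.right.approx m x = 0) ∨
        (l x = 1 ∧ c.left.approx m x = 1) := fun x => by
      by_cases hx : x ∈ c.left.U
      · have := c.left_U_subset_right_C hx
        exact .inl ⟨hrC x this, c.right.approx_of_mem_C m this⟩
      · exact .inr ⟨hlU x hx, c.left.approx_of_notMem_U m hx⟩
    refine ⟨⟨⟨fun x => (l x + r x) / 2, fun x y => ?_⟩, fun x y => ?_⟩, fun x => ?_,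
      fun x hx => ?_, fun x hx => ?_, fun x => ?_⟩
    · change (l (x ⊔ y) + r (x ⊔ y)) / 2 = ((l x + r x) / 2) ⊔ ((l y + r y) / 2)
      rw [SupHomClass.map_sup, SupHomClass.map_sup]
      rcases hsplit x with ⟨hx, -⟩ | ⟨hx, -⟩ <;> rcases hsplit y with ⟨hy, -⟩ | ⟨hy, -⟩ <;>
        rw [hx, hy] <;> have := hl x <;> have := hl y <;> have := hr x <;> have := hr y <;>
        grind
    · change (l (x ⊓ y) + r (x ⊓ y)) / 2 = ((l x + r x) / 2) ⊓ ((l y + r y) / 2)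
      rw [InfHomClass.map_inf, InfHomClass.map_inf]
      rcases hsplit x with ⟨hx, -⟩ | ⟨hx, -⟩ <;> rcases hsplit y with ⟨hy, -⟩ | ⟨hy, -⟩ <;>
        rw [hx, hy] <;> have := hl x <;> have := hl y <;> have := hr x <;> have := hr y <;>
        grind
    · change (l x + r x) / 2 ∈ _
      have := hl x
      have := hr x
      simp only [mem_Icc] at *
      constructor <;> linarith
    · change (l x + r x) / 2 = 0
      rw [hlC x hx, hrC x (c.subset_right_C hx)]; norm_num
    · change (l x + r x) / 2 = 1
      rw [hrU x hx, hlU x fun hU => hx (c.left_U_subset hU)]; norm_num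
    · change |(l x + r x) / 2 - midpoint ℝ (c.left.approx m x) (c.right.approx m x)| ≤ _
      have h1 := abs_le.1 (hla x)
      have h2 := abs_le.1 (hra x)
      rw [midpoint_eq_smul_add, invOf_eq_inv, smul_eq_mul, pow_succ, abs_le]
      rcases hsplit x with ⟨hx, hx'⟩ | ⟨hx, hx'⟩ <;> rw [hx, hx'] <;> rw [hx, hx'] at * <;>
        constructor <;> linarith [h1.1, h1.2, h2.1, h2.2]

/-- Continuous lattice homomorphisms to the unit interval separate points of a compact
distributive lattice of finite breadth. -/
theorem NoBoolCube.exists_continuous_latticeHom {n : ℕ} (h : NoBoolCube n L) {a b : L}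
    (hba : ¬ b ≤ a) :
    ∃ f : LatticeHom L ℝ, Continuous f ∧ (∀ x, f x ∈ Icc (0 : ℝ) 1) ∧ f a = 0 ∧ f b = 1 := by
  let c : Urysohns.CU (IdealSeparated (L := L)) :=
    { C := Iic a
      U := (Ici b)ᶜ
      P_C_U := ⟨a, b, hba, subset_rfl, (compl_compl _).subset⟩
      closed_C := isClosed_Iic_of_topologicalLattice a
      open_U := (isClosed_Ici_of_topologicalLattice b).isOpen_compl
      subset := fun x hx hx' => hba (le_trans hx' hx)
      hP := fun _ hP _ _ => h.exists_between hP }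
  choose g _ _ _ hg using fun m => Urysohns.CU.exists_latticeHom_near_approx m c
  have hlim : ∀ x, Tendsto (fun m => g m x) atTop (𝓝 (c.lim x)) := fun x => by
    have h0 : Tendsto (fun m => g m x - c.approx m x) atTop (𝓝 0) :=
      squeeze_zero_norm (fun m => hg m x)
        (tendsto_pow_atTop_nhds_zero_of_lt_one (by norm_num) (by norm_num))
    simpa using h0.add (c.tendsto_approx_atTop x)
  refine ⟨⟨⟨c.lim, fun x y => ?_⟩, fun x y => ?_⟩, c.continuous_lim, c.lim_mem_Icc,
    c.lim_of_mem_C a self_mem_Iic, c.lim_of_notMem_U b fun hb => hb self_mem_Ici⟩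
  · refine tendsto_nhds_unique (hlim _) ?_
    simpa using (hlim x).sup_nhds (hlim y)
  · refine tendsto_nhds_unique (hlim _) ?_
    simpa using (hlim x).inf_nhds (hlim y)

end CompactLattices

section MedianIntervals

namespace MedianStruct

variable {X : Type*} (M : MedianStruct X)

theorem med_left_comm (a b c : X) : M.med a b c = M.med b a c := by
  exact M.med_perm (Equiv.swap 0 1) ![b, a, c]

theorem med_right_comm (a b c : X) : M.med a b c = M.med a c b := by
  exact M.med_perm (Equiv.swap 1 2) ![a, c, b]

theorem med_med_assoc (x a b c : X) :
    M.med x (M.med x a b) c = M.med x a (M.med x b c) := by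
  have h := M.med_assoc a b x x c
  grind [M.med_left_comm, M.med_right_comm, M.med_idem]

theorem med_mem_interval {x y a b : X} (hb : b ∈ M.interval x y) :
    M.med x a b ∈ M.interval x y := by
  change M.med x y _ = _
  have hb : M.med x y b = b := hb
  have h := M.med_assoc a b x x y
  grind [M.med_left_comm, M.med_right_comm, M.med_idem]

theorem interval_symm (x y : X) : M.interval x y = M.interval y x := by
  ext z
  exact iff_of_eq (congrArg (· = z) (M.med_left_comm x y z))

theorem med_absorb {x y a b : X} (ha : a ∈ M.interval x y) :
    M.med x a (M.med y a b) = a := by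
  have ha : M.med x y a = a := ha
  have h := M.med_assoc b y a x a
  grind [M.med_left_comm, M.med_right_comm, M.med_idem]

theorem left_mem_interval (x y : X) : x ∈ M.interval x y := by
  change M.med x y x = x
  rw [med_left_comm, med_idem]

theorem right_mem_interval (x y : X) : y ∈ M.interval x y := M.med_idem x y

theorem med_med_mem_interval (x y z : X) : M.med x y z ∈ M.interval x y := by
  change M.med x y _ = _
  have h := M.med_assoc z x y x y
  grind [M.med_left_comm, M.med_right_comm, M.med_idem]

/-- The projection to an interval is median-preserving. -/
theorem med_med_distrib (x y a b c : X) :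
    M.med x y (M.med a b c) = M.med (M.med x y a) (M.med x y b) (M.med x y c) := by
  have h1 := M.med_assoc a b c x y
  have h2 := M.med_assoc (M.med b x y) a (M.med c x y) x y
  have h3 := M.med_assoc b x y x y
  have h4 := M.med_assoc c x y x y
  have h5 := M.med_med_mem_interval x y (M.med a b c)
  change M.med x y _ = _ at h5
  grind [M.med_left_comm, M.med_right_comm, M.med_idem]

/-- An interval `[x, y]` is a distributive lattice with least element `x` and greatest
element `y`. -/
instance intervalDistribLattice (x y : X) : DistribLattice (M.interval x y) :=
  letI : Max (M.interval x y) := ⟨fun a b => ⟨M.med y a b,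
    (M.interval_symm y x).subset (M.med_mem_interval ((M.interval_symm x y).subset b.2))⟩⟩
  letI : Min (M.interval x y) := ⟨fun a b => ⟨M.med x a b, M.med_mem_interval b.2⟩⟩
  letI := Lattice.mk'
    (fun a b : M.interval x y => Subtype.ext (M.med_right_comm y a b))
    (fun a b c => Subtype.ext (M.med_med_assoc y a b c))
    (fun a b => Subtype.ext (M.med_right_comm x a b))
    (fun a b c => Subtype.ext (M.med_med_assoc x a b c))
    (fun a b => Subtype.ext (M.med_absorb (M.interval_symm x y ▸ a.2)))
    (fun a b => Subtype.ext (M.med_absorb a.2))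
  DistribLattice.ofInfSupLe fun a b c => le_of_eq <| Subtype.ext <| by
    change M.med x a (M.med y b c) = M.med y (M.med x a b) (M.med x a c)
    have h := M.med_assoc y b c x a
    have ha : M.med x y a = a := a.2
    have h' := M.med_assoc b c y x a
    grind [M.med_left_comm, M.med_right_comm]

variable {M}
variable {x y : X}

theorem coe_inf (a b : M.interval x y) : ((a ⊓ b : M.interval x y) : X) = M.med x a b := rfl

theorem coe_sup (a b : M.interval x y) : ((a ⊔ b : M.interval x y) : X) = M.med y a b := rfl

instance intervalBoundedOrder : BoundedOrder (M.interval x y) where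
  bot := ⟨x, M.left_mem_interval x y⟩
  bot_le a := inf_eq_left.1 <| Subtype.ext <| by
    change M.med x x a = x
    rw [med_right_comm, med_left_comm, med_idem]
  top := ⟨y, M.right_mem_interval x y⟩
  le_top a := sup_eq_right.1 <| Subtype.ext <| by
    change M.med y a y = y
    rw [med_left_comm, med_idem]

theorem med_coe_mem (a b c : M.interval x y) : M.med a b c ∈ M.interval x y := by
  change M.med x y _ = _
  rw [med_med_distrib, show M.med x y a = a from a.2, show M.med x y b = b from b.2,
    show M.med x y c = c from c.2]

theorem med_coe_of_le {b u v : M.interval x y} (hu : u ≤ b) (hv : v ≤ b) :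
    M.med b u v = (u ⊔ v : M.interval x y) := by
  have hb : M.med x y b = b := b.2
  have hle : ∀ {u v : M.interval x y}, u ≤ b → u ≤ ⟨M.med b u v, med_coe_mem b u v⟩ := by
    intro u v hu
    refine inf_eq_left.1 (Subtype.ext ?_)
    have hu : M.med x u b = u := congrArg Subtype.val (inf_eq_left.2 hu)
    have h := M.med_assoc v b u u x
    rw [coe_inf]
    grind [M.med_left_comm, M.med_right_comm, M.med_idem]
  refine congrArg Subtype.val (?_ : (⟨M.med b u v, med_coe_mem b u v⟩ : M.interval x y) = u ⊔ v)
  refine le_antisymm (inf_eq_right.1 (Subtype.ext ?_)) (sup_le (hle hu) ?_)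
  · have h := M.med_assoc x y b u v
    rw [hb] at h
    exact h.symm
  · exact (hle (v := u) hv).trans_eq (Subtype.ext (M.med_right_comm _ _ _))

theorem inf_med_coe (a b c : M.interval x y) :
    a ⊓ ⟨M.med a b c, med_coe_mem a b c⟩ = (a ⊓ b) ⊔ (a ⊓ c) := by
  refine Subtype.ext ((?_ : _ = M.med a (a ⊓ b : M.interval x y) (a ⊓ c : M.interval x y)).trans
    (med_coe_of_le inf_le_left inf_le_left))
  have h := M.med_assoc a b c x a
  simp only [coe_inf]
  grind [M.med_left_comm, M.med_right_comm]

theorem med_coe_eq (a b c : M.interval x y) :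
    M.med a b c = ((a ⊓ b) ⊔ (b ⊓ c) ⊔ (a ⊓ c) : M.interval x y) := by
  set d : M.interval x y := ⟨M.med a b c, med_coe_mem a b c⟩ with hd
  refine congrArg Subtype.val (?_ : d = _)
  have ha : a ⊓ d = (a ⊓ b) ⊔ (a ⊓ c) := inf_med_coe a b c
  have hb : b ⊓ d = (b ⊓ a) ⊔ (b ⊓ c) := by
    rw [← inf_med_coe b a c]
    exact congrArg (b ⊓ ·) (Subtype.ext (M.med_left_comm _ _ _))
  have hle : d ≤ a ⊔ b := by
    refine inf_eq_right.1 (Subtype.ext ?_)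
    have h := M.med_assoc c a b x (a ⊔ b : M.interval x y)
    have h1 : M.med x a (a ⊔ b : M.interval x y) = a :=
      congrArg Subtype.val (inf_sup_self (a := a) (b := b))
    have h2 : M.med x b (a ⊔ b : M.interval x y) = b :=
      congrArg Subtype.val (inf_eq_left.2 (le_sup_right : b ≤ a ⊔ b))
    rw [coe_inf]
    change M.med x (a ⊔ b : M.interval x y) (M.med a b c) = M.med a b c
    grind [M.med_left_comm, M.med_right_comm]
  rw [← inf_eq_right.2 hle, inf_sup_right, ha, hb, inf_comm b a]
  apply le_antisymm
  · simp only [sup_le_iff]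
    refine ⟨⟨?_, ?_⟩, ?_, ?_⟩ <;> simp [le_sup_of_le_left]
  · simp only [sup_le_iff]
    refine ⟨⟨?_, ?_⟩, ?_⟩ <;> simp [le_sup_of_le_left, le_sup_of_le_right]

/-- A Boolean sublattice of an interval is a median cube. -/
theorem le_medRank_of_latticeHom {k : ℕ} (F : LatticeHom (Fin k → Bool) (M.interval x y))
    (hF : Function.Injective F) : (k : ℕ∞) ≤ medRank M := by
  refine le_iSup₂_of_le k ⟨fun A => F A, Subtype.val_injective.comp hF, fun A B C => ?_⟩ le_rfl
  rw [med_coe_eq, ← map_inf, ← map_inf, ← map_inf, ← map_sup, ← map_sup]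
  rfl

theorem exists_noBoolCube_interval (hrank : medRank M < ⊤) (x y : X) :
    ∃ n, NoBoolCube n (M.interval x y) := by
  obtain ⟨r, hr⟩ := ENat.ne_top_iff_exists.1 hrank.ne
  refine ⟨r + 1, fun F hF => ?_⟩
  have h := le_medRank_of_latticeHom F hF
  rw [← hr, Nat.cast_le] at h
  omega

section Topology

variable [TopologicalSpace X]

theorem intervalTopologicalLattice
    (hm : Continuous fun p : X × X × X => M.med p.1 p.2.1 p.2.2) (x y : X) :
    TopologicalLattice (M.interval x y) where
  continuous_inf := Continuous.subtype_mk
    (hm.comp (by fun_prop :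
      Continuous fun p : M.interval x y × M.interval x y => (x, (p.1 : X), (p.2 : X)))) _
  continuous_sup := Continuous.subtype_mk
    (hm.comp (by fun_prop :
      Continuous fun p : M.interval x y × M.interval x y => (y, (p.1 : X), (p.2 : X)))) _

/-- In a compact median algebra of finite rank, continuous median-preserving maps to the unit
interval separate points. -/
theorem exists_mem_MCfam_separating [T2Space X] [CompactSpace X]
    (hm : Continuous fun p : X × X × X => M.med p.1 p.2.1 p.2.2)
    (hrank : medRank M < ⊤) {x y : X} (hxy : x ≠ y) :
    ∃ f ∈ MCfam M, f x = 0 ∧ f y = 1 := by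
  have := intervalTopologicalLattice hm x y
  have hproj : Continuous fun z => M.med x y z := hm.comp (by fun_prop :
    Continuous fun z : X => (x, y, z))
  have : CompactSpace (M.interval x y) :=
    isCompact_iff_compactSpace.1 (isClosed_eq hproj continuous_id).isCompact
  obtain ⟨n, hn⟩ := exists_noBoolCube_interval hrank x y
  obtain ⟨f, hfc, hf01, hf0, hf1⟩ := hn.exists_continuous_latticeHom
    (a := (⊥ : M.interval x y)) (b := ⊤)
    fun h => hxy (congrArg Subtype.val (le_antisymm bot_le h))
  let p : X → M.interval x y := fun z => ⟨M.med x y z, M.med_med_mem_interval x y z⟩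
  refine ⟨f ∘ p, ⟨hfc.comp (hproj.subtype_mk _), fun a b c => ?_, fun z => hf01 _⟩, ?_, ?_⟩
  · have : p (M.med a b c) = (p a ⊓ p b) ⊔ (p b ⊓ p c) ⊔ (p a ⊓ p c) :=
      Subtype.ext ((M.med_med_distrib x y a b c).trans (med_coe_eq (p a) (p b) (p c)))
    simp only [Function.comp_apply, this, map_sup, map_inf]
    rfl
  · rw [← hf0]
    exact congrArg f (Subtype.ext (M.left_mem_interval x y))
  · rw [← hf1]
    exact congrArg f (Subtype.ext (M.right_mem_interval x y))

end Topology

/-- Independent median-preserving functions give rise to a median cube. -/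
theorem le_medRank_of_indepFunFin {k : ℕ} {f : Fin k → X → ℝ}
    (hf : ∀ i, IsMedianPreserving M (f i)) (hind : IndepFunFin f) : (k : ℕ∞) ≤ medRank M := by
  classical
  obtain ⟨a, b, hab, hind⟩ := hind
  have hpt : ∀ S : Finset (Fin k), ∃ z, ∀ i, (i ∈ S → b ≤ f i z) ∧ (i ∉ S → f i z ≤ a) := by
    intro S
    obtain ⟨z, hz1, hz2⟩ := hind Sᶜ S disjoint_compl_left
    simp only [mem_iInter, mem_ofPred_eq, Finset.mem_compl] at hz1 hz2
    exact ⟨z, fun i => ⟨hz2 i, hz1 i⟩⟩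
  obtain ⟨x, hx⟩ := hpt ∅
  obtain ⟨y, hy⟩ := hpt Finset.univ
  choose z hz using fun i => hpt {i}
  replace hx : ∀ i, f i x ≤ a := fun i => (hx i).2 (by simp)
  replace hy : ∀ i, b ≤ f i y := fun i => (hy i).1 (by simp)
  have hmem : ∀ (u : M.interval x y) i, f i x ≤ f i u ∧ f i u ≤ f i y := by
    intro u i
    have h := hf i x y u
    rw [show M.med x y u = u from u.2] at h
    have := hx i
    have := hy i
    unfold realMed at h
    grind
  have hinf : ∀ (u v : M.interval x y) i,
      f i (u ⊓ v : M.interval x y) = min (f i u) (f i v) := by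
    intro u v i
    rw [coe_inf, hf i]
    have := hmem u i
    have := hmem v i
    unfold realMed
    grind
  have hsup : ∀ (u v : M.interval x y) i,
      f i (u ⊔ v : M.interval x y) = max (f i u) (f i v) := by
    intro u v i
    rw [coe_sup, hf i]
    have := hmem u i
    have := hmem v i
    unfold realMed
    grind
  let e : Fin k → M.interval x y := fun i => ⟨M.med x y (z i), M.med_med_mem_interval x y _⟩
  have he : ∀ i, b ≤ f i (e i) := by
    intro i
    have := hx i
    have := hy i
    have := (hz i i).1 (by simp)
    change b ≤ f i (M.med x y (z i))
    rw [hf i]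
    unfold realMed
    grind
  have he' : ∀ i j, j ≠ i → f j (e i) ≤ a := by
    intro i j hj
    have := hx j
    have := hy j
    have := (hz i j).2 (by simpa using hj)
    change f j (M.med x y (z i)) ≤ a
    rw [hf j]
    unfold realMed
    grind
  let s : M.interval x y :=
    (Finset.univ : Finset (Fin k)).offDiag.sup fun p => e p.1 ⊓ e p.2
  have hs : ∀ i, f i s ≤ a := by
    intro i
    refine Finset.sup_induction (p := fun u : M.interval x y => f i u ≤ a) (hx i)
      (fun u hu v hv => ?_) fun p hp => ?_
    · rw [hsup]
      exact max_le hu hv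
    · rw [hinf]
      obtain h | h := eq_or_ne i p.1
      · exact min_le_of_right_le (he' _ _ (h ▸ (Finset.mem_offDiag.1 hp).2.2))
      · exact min_le_of_left_le (he' _ _ h)
  obtain ⟨F, hF⟩ := exists_boolCube_of_pairwise_inf_eq (s := s) (e := fun i => e i ⊔ s)
    (fun i => by
      refine lt_of_le_of_ne le_sup_right fun h => ?_
      have h1 := hs i
      rw [h, hsup] at h1
      exact (hab.trans_le ((he i).trans (le_max_left _ _))).not_ge h1)
    (fun i j hij => by
      rw [← sup_inf_right, sup_eq_right]
      have hmem : (i, j) ∈ (Finset.univ : Finset (Fin k)).offDiag :=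
        Finset.mem_offDiag.2 ⟨Finset.mem_univ i, Finset.mem_univ j, hij⟩
      exact Finset.le_sup (f := fun p : Fin k × Fin k => e p.1 ⊓ e p.2) hmem)
  exact le_medRank_of_latticeHom F hF

/-- The edges of a median cube yield independent continuous median-preserving functions. -/
theorem exists_indepFunFin_of_cube [TopologicalSpace X] [T2Space X] [CompactSpace X]
    (hm : Continuous fun p : X × X × X => M.med p.1 p.2.1 p.2.2)
    (hrank : medRank M < ⊤) {n : ℕ} {φ : (Fin n → Bool) → X} (hφ : Function.Injective φ)
    (hφm : IsMedianHom (boolCubeMed (Fin n)) M φ) :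
    ∃ f : Fin n → X → ℝ, (∀ i, f i ∈ MCfam M) ∧ IndepFunFin f := by
  classical
  let v : Fin n → Fin n → Bool := fun i j => decide (j = i)
  have hv : ∀ i, φ (fun _ => false) ≠ φ (v i) := fun i h => by
    simpa [v] using congrFun (hφ h) i
  choose f hf hf0 hf1 using fun i => exists_mem_MCfam_separating hm hrank (hv i)
  have key : ∀ i A, f i (φ A) = if A i then 1 else 0 := by
    intro i A
    have h1 : (boolCubeMed (Fin n)).med (fun _ => false) (v i) A =
        if A i then v i else fun _ => false := by
      funext j
      by_cases hj : j = i
      · subst hj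
        cases hA : A j <;> simp [boolCubeMed, boolMed, v, hA]
      · cases hA : A i <;> simp [boolCubeMed, boolMed, v, hj]
    have h2 := (hf i).2.1 (φ fun _ => false) (φ (v i)) (φ A)
    have h3 := (hf i).2.2 (φ A)
    rw [← hφm, h1, hf0, hf1] at h2
    have h4 : realMed 0 1 (f i (φ A)) = f i (φ A) := by
      have := h3.1
      have := h3.2
      unfold realMed
      grind
    rw [h4] at h2
    rw [← h2]
    split_ifs
    · exact hf1 i
    · exact hf0 i
  refine ⟨f, hf, 0, 1, one_pos, fun P Q hPQ => ⟨φ fun i => decide (i ∈ Q), ?_, ?_⟩⟩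
  · refine mem_iInter₂.2 fun i hi => ?_
    have := Finset.disjoint_left.1 hPQ hi
    simp [key, this]
  · refine mem_iInter₂.2 fun i hi => ?_
    simp [key, hi]

end MedianStruct

end MedianIntervals

/-- for a compact (Hausdorff) topological median algebra of finite
rank, the independence number of the family of all continuous median-preserving
maps `X → [0,1]` equals the rank of `X`. -/
theorem indFun_MC_eq_medRank {X : Type*} [TopologicalSpace X] [T2Space X]
    [CompactSpace X] (M : MedianStruct X)
    (hm : Continuous fun p : X × X × X => M.med p.1 p.2.1 p.2.2)
    (hrank : medRank M < ⊤) :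
    indFun (MCfam M) = medRank M := by
  apply le_antisymm
  · exact iSup₂_le fun k ⟨f, hf, hind⟩ =>
      MedianStruct.le_medRank_of_indepFunFin (fun i => (hf i).2.1) hind
  · exact iSup₂_le fun n ⟨φ, hφ, hφm⟩ =>
      le_iSup₂_of_le n (MedianStruct.exists_indepFunFin_of_cube hm hrank hφ hφm) le_rfl
end
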